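/- arXiv:0712.3023 — 3 statements merged into one kernel-verified Lean document; each statement's English description precedes it below -/
import Mathlib

section
/- Let l₁ ≤ l₂ and m₁ ≤ m₂ be real numbers with l₂ < m₁. Let h, h' : ℝ → ℝ be functions such that h has (l₁, l₂)-bounded slope and h' has (m₁, m₂)-bounded slope, and let x₀ be the unique point with h(x₀) = h'(x₀). Then the function x ↦ max(h(x), h'(x)) coincides with h on {x ≤ x₀} and with h' on {x ≥ x₀}, and it is not differentiable at x₀. -/
/-- A function `h : ℝ → ℝ` has `(l₁, l₂)`-bounded slope if for all `x < y`,
`l₁ * (y - x) ≤ h y - h x ≤ l₂ * (y - x)`. -/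
def HasBddSlope (l₁ l₂ : ℝ) (h : ℝ → ℝ) : Prop :=
  ∀ x y : ℝ, x < y → l₁ * (y - x) ≤ h y - h x ∧ h y - h x ≤ l₂ * (y - x)

theorem max_of_bddSlope_not_differentiableAt
    (l₁ l₂ m₁ m₂ : ℝ) (hl : l₁ ≤ l₂) (hm : m₁ ≤ m₂) (hlm : l₂ < m₁)
    (h h' : ℝ → ℝ) (hh : HasBddSlope l₁ l₂ h) (hh' : HasBddSlope m₁ m₂ h')
    (x₀ : ℝ) (hx₀ : h x₀ = h' x₀) :
    (∀ x ≤ x₀, max (h x) (h' x) = h x) ∧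
    (∀ x, x₀ ≤ x → max (h x) (h' x) = h' x) ∧
    ¬ DifferentiableAt ℝ (fun x => max (h x) (h' x)) x₀ := by
  have key1 : ∀ x ≤ x₀, max (h x) (h' x) = h x := by
    intro x hx
    rcases hx.eq_or_lt with rfl | hx
    · simp [hx₀]
    · apply max_eq_left
      nlinarith [(hh x x₀ hx).2, (hh' x x₀ hx).1]
  have key2 : ∀ x, x₀ ≤ x → max (h x) (h' x) = h' x := by
    intro x hx
    rcases hx.eq_or_lt with rfl | hx
    · simp [hx₀]
    · apply max_eq_right
      nlinarith [(hh x₀ x hx).2, (hh' x₀ x hx).1]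
  refine ⟨key1, key2, fun hd => ?_⟩
  have ht := hasDerivAt_iff_tendsto_slope.1 hd.hasDerivAt
  have h1 := le_of_tendsto (b := l₂) (ht.mono_left (nhdsLT_le_nhdsNE x₀)) (by
    filter_upwards [self_mem_nhdsWithin] with x hx
    have hx : x < x₀ := hx
    rw [slope_comm, slope_def_field, div_le_iff₀ (sub_pos.2 hx), key1 x hx.le, key1 x₀ le_rfl]
    exact (hh x x₀ hx).2)
  have h2 := ge_of_tendsto (b := m₁) (ht.mono_left (nhdsGT_le_nhdsNE x₀)) (by
    filter_upwards [self_mem_nhdsWithin] with x hx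
    have hx : x₀ < x := hx
    rw [slope_def_field, le_div_iff₀ (sub_pos.2 hx), key2 x hx.le, key2 x₀ le_rfl]
    exact (hh' x₀ x hx).1)
  linarith
end

section
/- Let a ∈ (3,4), let f_a(x) = a·x·(1 − x), and let K = [f_a(f_a(1/2)), f_a(1/2)] be the 'core' interval bounded by the second and first images of the critical point c = 1/2. Then f_a(K) ⊆ K, and for every x ∈ (0,1) there exists n ≥ 0 such that f_a^n(x) ∈ K. -/
open Set

theorem core_interval_absorbing
    (a : ℝ) (ha : a ∈ Ioo (3 : ℝ) 4)
    (f : ℝ → ℝ) (hf : ∀ x, f x = a * x * (1 - x))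
    (K : Set ℝ) (hK : K = Icc (f (f (1 / 2))) (f (1 / 2))) :
    MapsTo f K K ∧ ∀ x ∈ Ioo (0 : ℝ) 1, ∃ n : ℕ, f^[n] x ∈ K := by
  obtain ⟨h3, h4⟩ := ha
  have hM : f (1 / 2) = a / 4 := by rw [hf]; ring
  rw [hM] at hK
  have hL : f (a / 4) = a * (a / 4) * (1 - a / 4) := hf _
  obtain ⟨L, hLd⟩ : ∃ L, L = f (a / 4) := ⟨_, rfl⟩
  rw [← hLd] at hK hL
  have hle : ∀ x, f x ≤ a / 4 := by
    intro x
    rw [hf]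
    nlinarith [mul_nonneg (by linarith : (0 : ℝ) ≤ a) (sq_nonneg (x - 1 / 2))]
  have hLpos : 0 < L := by
    rw [hL]
    exact mul_pos (mul_pos (by linarith) (by linarith)) (by linarith)
  have hq : 1 < a * (1 - L) := by
    have h : 0 < (a - 2) ^ 3 * (a + 2) :=
      mul_pos (pow_pos (by linarith) 3) (by linarith)
    rw [hL]
    nlinarith
  subst hK
  constructor
  · rintro x ⟨h1, h2⟩
    refine ⟨?_, hle x⟩
    rcases le_total (1 - a / 4) x with h | h
    · have : f x - L = a * ((a / 4 - x) * (x - (1 - a / 4))) := by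
        rw [hf, hL]; ring
      have h' : 0 ≤ a * ((a / 4 - x) * (x - (1 - a / 4))) :=
        mul_nonneg (by linarith) (mul_nonneg (by linarith) (by linarith))
      linarith
    · have h5 : 1 ≤ a * (1 - x) := by nlinarith
      have : f x = x * (a * (1 - x)) := by rw [hf]; ring
      nlinarith
  · rintro x ⟨hx0, hx1⟩
    by_contra! hno
    have hf0 : 0 < f x := by
      rw [hf]; exact mul_pos (mul_pos (by linarith) hx0) (by linarith)
    have key : ∀ n : ℕ, (a * (1 - L)) ^ n * f x ≤ f^[n + 1] x := by
      intro n
      induction n with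
      | zero => simp
      | succ n ih =>
        have hup : f^[n + 1] x ≤ a / 4 := by
          rw [Function.iterate_succ_apply']; exact hle _
        have hlt : f^[n + 1] x < L := by
          by_contra! h
          exact hno (n + 1) ⟨h, hup⟩
        have hpos : 0 < f^[n + 1] x :=
          lt_of_lt_of_le (mul_pos (pow_pos (by linarith) n) hf0) ih
        rw [Function.iterate_succ_apply' f (n + 1), hf (f^[n + 1] x)]
        calc (a * (1 - L)) ^ (n + 1) * f x
            = (a * (1 - L)) * ((a * (1 - L)) ^ n * f x) := by ring
          _ ≤ (a * (1 - L)) * f^[n + 1] x :=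
              mul_le_mul_of_nonneg_left ih (by linarith)
          _ ≤ (a * (1 - f^[n + 1] x)) * f^[n + 1] x := by
              apply mul_le_mul_of_nonneg_right _ hpos.le
              exact mul_le_mul_of_nonneg_left (by linarith) (by linarith)
          _ = _ := by ring
    obtain ⟨n, hn⟩ := pow_unbounded_of_one_lt (1 / f x) hq
    rw [div_lt_iff₀ hf0] at hn
    have h1 := key n
    rw [Function.iterate_succ_apply'] at h1
    have h2 := hle (f^[n] x)
    linarith
end

section
/- Let f₄(x) = 4x(1 − x). For every ε > 0 there exists δ > 0 such that the set of points of [0,1] whose forward orbit never enters the δ-ball around the critical point 1/2, namely {x ∈ [0,1] : |f₄^n(x) − 1/2| ≥ δ for all n ≥ 0}, has Hausdorff dimension greater than 1 − ε. (The Chebyshev map has hyperbolic dimension equal to 1.) -/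
open Set

namespace ChebAux

lemma dimH_range_le {ι : Type*} [Nonempty ι] (X G : ι → ℝ) (C r : NNReal) (hr : 0 < r)
    (h : ∀ a a', |G a - G a'| ≤ C * |X a - X a'| ^ (r : ℝ)) :
    dimH (range G) ≤ dimH (range X) / r := by
  have hH : HolderOnWith C r (fun x => G (Function.invFun X x)) (range X) := by
    rintro _ ⟨a, rfl⟩ _ ⟨b, rfl⟩
    have ha : X (Function.invFun X (X a)) = X a := Function.invFun_eq ⟨a, rfl⟩
    have hb : X (Function.invFun X (X b)) = X b := Function.invFun_eq ⟨b, rfl⟩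
    have := h (Function.invFun X (X a)) (Function.invFun X (X b))
    rw [ha, hb] at this
    rw [edist_dist, edist_dist, Real.dist_eq, Real.dist_eq,
      ENNReal.ofReal_rpow_of_nonneg (abs_nonneg _) r.coe_nonneg, ← ENNReal.ofReal_coe_nnreal,
      ← ENNReal.ofReal_mul C.coe_nonneg]
    exact ENNReal.ofReal_le_ofReal this
  have := hH.dimH_image_le hr
  refine le_trans (dimH_mono ?_) this
  rintro _ ⟨a, rfl⟩
  refine ⟨X a, ⟨a, rfl⟩, ?_⟩
  have ha : X (Function.invFun X (X a)) = X a := Function.invFun_eq ⟨a, rfl⟩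
  have := h (Function.invFun X (X a)) a
  rw [ha, sub_self, abs_zero, Real.zero_rpow (by exact_mod_cast hr.ne'), mul_zero] at this
  exact sub_eq_zero.1 (abs_eq_zero.1 (le_antisymm this (abs_nonneg _)))

/-- the digit embedding -/
def emb {A : ℕ} (a : ℕ → Fin A) : ℕ → Fin (4 * A) :=
  fun i => ⟨4 * (a i).1 + 1, by have := (a i).2; omega⟩

noncomputable def Y {A : ℕ} (a : ℕ → Fin A) : ℝ := Real.ofDigits (emb a)

lemma Y_succ {A : ℕ} (a : ℕ → Fin A) :
    Y a = ((4 * ((a 0).1 : ℝ) + 1) + Y (fun i => a (i + 1))) / (4 * A) := by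
  unfold Y
  rw [Real.ofDigits_eq_sum_add_ofDigits _ 1]
  have e : (fun i => emb a (i + 1)) = emb (fun i => a (i + 1)) := rfl
  rw [e]
  generalize Real.ofDigits (emb (fun i => a (i + 1))) = z
  simp [Real.ofDigitsTerm, emb]
  ring

lemma Y_bd {A : ℕ} (a : ℕ → Fin A) :
    1 / (4 * (A : ℝ)) ≤ Y a ∧ Y a ≤ 1 - 1 / (4 * (A : ℝ)) := by
  have hA : 0 < A := Fin.pos (a 0)
  have hA' : (0 : ℝ) < A := by exact_mod_cast hA
  rw [Y_succ]
  have h0 : 0 ≤ Y (fun i => a (i + 1)) := Real.ofDigits_nonneg _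
  have h1 : Y (fun i => a (i + 1)) ≤ 1 := Real.ofDigits_le_one _
  have h2 : ((a 0).1 : ℝ) + 1 ≤ A := by exact_mod_cast (a 0).2
  have h3 : (0 : ℝ) ≤ ((a 0).1 : ℝ) := by positivity
  constructor
  · gcongr
    linarith
  · rw [le_sub_iff_add_le, ← add_div, div_le_one (by positivity)]
    linarith

lemma Y_shift {A : ℕ} (k : ℕ) : ∀ (a : ℕ → Fin A),
    ∃ m : ℕ, (4 * (A : ℝ)) ^ k * Y a = m + Y (fun i => a (i + k)) := by
  induction k with
  | zero => intro a; exact ⟨0, by simp⟩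
  | succ k ih =>
    intro a
    have hA : (A : ℝ) ≠ 0 := by exact_mod_cast (Fin.pos (a 0)).ne'
    obtain ⟨m, hm⟩ := ih (fun i => a (i + 1))
    refine ⟨(4 * A) ^ k * (4 * (a 0).1 + 1) + m, ?_⟩
    have e : (fun i => a (i + (k + 1))) = fun i => a (i + k + 1) := rfl
    rw [e]
    push_cast
    rw [add_assoc, ← hm, Y_succ, pow_succ]
    field_simp

lemma Y_gap {A : ℕ} (a b : ℕ → Fin A) (k : ℕ) (hk : ∀ i < k, a i = b i) (hne : a k ≠ b k) :
    1 / (4 * (A : ℝ)) ^ (k + 1) ≤ |Y a - Y b| := by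
  have hA : (0 : ℝ) < A := by exact_mod_cast (Fin.pos (a 0))
  have key : ∀ a b : ℕ → Fin A, a 0 ≠ b 0 → 1 / (4 * (A : ℝ)) ≤ |Y a - Y b| := by
    intro a b hne
    rw [Y_succ a, Y_succ b, ← sub_div, abs_div, abs_of_pos (by positivity : (0 : ℝ) < 4 * A)]
    gcongr
    have h0 : 0 ≤ Y (fun i => a (i + 1)) := Real.ofDigits_nonneg _
    have h1 : Y (fun i => a (i + 1)) ≤ 1 := Real.ofDigits_le_one _
    have h2 : 0 ≤ Y (fun i => b (i + 1)) := Real.ofDigits_nonneg _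
    have h3 : Y (fun i => b (i + 1)) ≤ 1 := Real.ofDigits_le_one _
    rcases lt_or_gt_of_ne hne with h | h
    · have : ((a 0).1 : ℝ) + 1 ≤ (b 0).1 := by exact_mod_cast h
      rw [le_abs]; right; linarith
    · have : ((b 0).1 : ℝ) + 1 ≤ (a 0).1 := by exact_mod_cast h
      rw [le_abs]; left; linarith
  induction k generalizing a b with
  | zero => simpa using key a b hne
  | succ k ih =>
    have := ih (fun i => a (i + 1)) (fun i => b (i + 1))
      (fun i hi => hk (i + 1) (by omega)) hne
    rw [Y_succ a, Y_succ b, hk 0 (by omega), ← sub_div, abs_div,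
      abs_of_pos (by positivity : (0 : ℝ) < 4 * A), add_sub_add_left_eq_sub, pow_succ, ← div_div]
    gcongr

lemma sin_lower {B v : ℝ} (h1 : 1 / B ≤ v) (h2 : v ≤ 1 - 1 / B) (hB : 0 < B) :
    2 / B ≤ Real.sin (Real.pi * v) := by
  have hp := Real.pi_pos
  have hb : 0 < 1 / B := by positivity
  have e : 2 / B = 2 * (1 / B) := by ring
  rcases le_total v (1 / 2) with h | h
  · have := Real.mul_le_sin (x := Real.pi * v) (by nlinarith) (by nlinarith)
    have e2 : 2 / Real.pi * (Real.pi * v) = 2 * v := by field_simp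
    linarith
  · have := Real.mul_le_sin (x := Real.pi * (1 - v)) (by nlinarith) (by nlinarith)
    have e2 : 2 / Real.pi * (Real.pi * (1 - v)) = 2 * (1 - v) := by field_simp
    have e3 : Real.sin (Real.pi * (1 - v)) = Real.sin (Real.pi * v) := by
      rw [← Real.sin_pi_sub]; ring_nf
    linarith

lemma sin_pow_lower {A : ℕ} (a : ℕ → Fin A) (k : ℕ) :
    2 / (4 * (A : ℝ)) ≤ |Real.sin (Real.pi * ((4 * (A : ℝ)) ^ k * Y a))| := by
  have hA : (0 : ℝ) < A := by exact_mod_cast (Fin.pos (a 0))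
  obtain ⟨m, hm⟩ := Y_shift k a
  rw [hm, show Real.pi * (m + Y (fun i => a (i + k))) =
    Real.pi * Y (fun i => a (i + k)) + m * Real.pi by ring, Real.sin_add_nat_mul_pi, abs_mul,
    abs_pow, abs_neg, abs_one, one_pow, one_mul]
  have := Y_bd (fun i => a (i + k))
  exact (sin_lower this.1 this.2 (by positivity)).trans (le_abs_self _)

lemma sin_two_pow (j : ℕ) (t : ℝ) :
    |Real.sin (2 ^ (j + 1) * t)| ≤ 2 ^ (j + 1) * |Real.cos t| := by
  induction j with
  | zero =>
    simp only [zero_add, pow_one]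
    rw [Real.sin_two_mul, abs_mul, abs_mul]
    have := Real.abs_sin_le_one t
    have h := abs_nonneg (Real.cos t)
    rw [abs_two]
    nlinarith
  | succ j ih =>
    rw [pow_succ' _ (j + 1), mul_assoc, Real.sin_two_mul, abs_mul, abs_mul, abs_two]
    have := Real.abs_cos_le_one (2 ^ (j + 1) * t)
    have h := abs_nonneg (Real.sin (2 ^ (j + 1) * t))
    nlinarith

lemma cos_lower {M : ℕ} (a : ℕ → Fin (2 ^ M)) (n : ℕ) :
    2 / (4 * 2 ^ M : ℝ) ^ 2 ≤ |Real.cos (Real.pi * (2 ^ n * Y a))| := by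
  have hB : (4 * 2 ^ M : ℝ) = 2 ^ (M + 2) := by ring
  set k := n / (M + 2) + 1 with hk
  obtain ⟨j, hj, hj2⟩ : ∃ j, (M + 2) * k = n + (j + 1) ∧ j + 1 ≤ M + 2 := by
    have h1 := Nat.div_add_mod n (M + 2)
    have h2 := Nat.mod_lt n (show 0 < M + 2 by omega)
    refine ⟨M + 2 - 1 - n % (M + 2), ?_, by omega⟩
    rw [hk, mul_add, mul_one]
    omega
  have h1 := sin_pow_lower a k
  have h2 := sin_two_pow j (Real.pi * (2 ^ n * Y a))
  push_cast at h1
  rw [hB] at h1 ⊢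
  rw [← pow_mul, hj, pow_add 2 n (j + 1), show Real.pi * (2 ^ n * 2 ^ (j + 1) * Y a) =
    2 ^ (j + 1) * (Real.pi * (2 ^ n * Y a)) by ring] at h1
  have h3 : (2 : ℝ) ^ (j + 1) ≤ 2 ^ (M + 2) := pow_le_pow_right₀ (by norm_num) hj2
  have h4 := abs_nonneg (Real.cos (Real.pi * (2 ^ n * Y a)))
  have h5 : 2 / (2 : ℝ) ^ (M + 2) ≤ 2 ^ (M + 2) * |Real.cos (Real.pi * (2 ^ n * Y a))| :=
    h1.trans (h2.trans (by gcongr))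
  have hpos : (0 : ℝ) < 2 ^ (M + 2) := by positivity
  rw [pow_two, ← div_div, div_le_iff₀ hpos]
  linarith

noncomputable def X {A : ℕ} (a : ℕ → Fin A) : ℝ := Real.sin (Real.pi * Y a / 2) ^ 2

lemma iter (f₄ : ℝ → ℝ) (hf : ∀ x, f₄ x = 4 * x * (1 - x)) (t : ℝ) (n : ℕ) :
    f₄^[n] (Real.sin t ^ 2) = Real.sin (2 ^ n * t) ^ 2 := by
  induction n with
  | zero => simp
  | succ n ih =>
    rw [Function.iterate_succ_apply', ih, hf, pow_succ' 2 n, mul_assoc 2, Real.sin_two_mul]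
    have := Real.sin_sq_add_cos_sq (2 ^ n * t)
    rw [show 1 - Real.sin (2 ^ n * t) ^ 2 = Real.cos (2 ^ n * t) ^ 2 by linarith]
    ring

lemma X_mem (f₄ : ℝ → ℝ) (hf : ∀ x, f₄ x = 4 * x * (1 - x)) {M : ℕ} (a : ℕ → Fin (2 ^ M)) :
    X a ∈ {x ∈ Icc (0 : ℝ) 1 | ∀ n : ℕ, 1 / (4 * 2 ^ M : ℝ) ^ 2 ≤ |f₄^[n] x - 1 / 2|} := by
  refine ⟨⟨by unfold X; positivity, Real.sin_sq_le_one _⟩, fun n => ?_⟩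
  have h := cos_lower a n
  rw [X, iter f₄ hf]
  have e : Real.sin (2 ^ n * (Real.pi * Y a / 2)) ^ 2 - 1 / 2
      = - (Real.cos (Real.pi * (2 ^ n * Y a)) / 2) := by
    rw [show Real.pi * (2 ^ n * Y a) = 2 * (2 ^ n * (Real.pi * Y a / 2)) by ring,
      Real.cos_two_mul]
    have := Real.sin_sq_add_cos_sq (2 ^ n * (Real.pi * Y a / 2))
    linarith
  rw [e, abs_neg, abs_div, abs_two, le_div_iff₀ (by norm_num)]
  calc _ = 2 / (4 * 2 ^ M : ℝ) ^ 2 := by ring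
    _ ≤ _ := h

lemma X_gap {A : ℕ} (a b : ℕ → Fin A) :
    2 / (4 * (A : ℝ)) * |Y a - Y b| ≤ |X a - X b| := by
  have hA : (0 : ℝ) < A := by exact_mod_cast (Fin.pos (a 0))
  have hp := Real.pi_pos
  obtain ⟨a1, a2⟩ := Y_bd a
  obtain ⟨b1, b2⟩ := Y_bd b
  have hb : 0 < 1 / (4 * (A : ℝ)) := by positivity
  have e : X a - X b = Real.sin (Real.pi * ((Y a + Y b) / 2))
      * Real.sin (Real.pi * (Y a - Y b) / 2) := by
    unfold X
    rw [show Real.pi * ((Y a + Y b) / 2) = Real.pi * Y a / 2 + Real.pi * Y b / 2 by ring,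
      show Real.pi * (Y a - Y b) / 2 = Real.pi * Y a / 2 - Real.pi * Y b / 2 by ring,
      Real.sin_add, Real.sin_sub]
    have h1 := Real.sin_sq_add_cos_sq (Real.pi * Y a / 2)
    have h2 := Real.sin_sq_add_cos_sq (Real.pi * Y b / 2)
    linear_combination Real.sin (Real.pi * Y b / 2) ^ 2 * h1
      - Real.sin (Real.pi * Y a / 2) ^ 2 * h2
  rw [e, abs_mul]
  have s1 : 2 / (4 * (A : ℝ)) ≤ Real.sin (Real.pi * ((Y a + Y b) / 2)) :=
    sin_lower (by linarith) (by linarith) (by positivity)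
  have hd : |Y a - Y b| ≤ 1 := by rw [abs_le]; constructor <;> linarith
  have e2 : |Real.pi * (Y a - Y b) / 2| = Real.pi * |Y a - Y b| / 2 := by
    rw [abs_div, abs_mul, abs_of_pos hp, abs_two]
  have s2 := Real.mul_abs_le_abs_sin (x := Real.pi * (Y a - Y b) / 2) (by rw [e2]; nlinarith)
  rw [e2, show 2 / Real.pi * (Real.pi * |Y a - Y b| / 2) = |Y a - Y b| by field_simp] at s2
  exact mul_le_mul (s1.trans (le_abs_self _)) s2 (abs_nonneg _) (abs_nonneg _)

lemma holder {A : ℕ} (r : NNReal) (hr : 0 < r) (hAr : (A : ℝ) = (4 * (A : ℝ)) ^ (r : ℝ))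
    (a b : ℕ → Fin A) :
    |Real.ofDigits a - Real.ofDigits b| ≤
      (((4 * (A : NNReal)) ^ 2 / 2) ^ (r : ℝ) : NNReal) * |X a - X b| ^ (r : ℝ) := by
  have hA : (0 : ℝ) < A := by exact_mod_cast (Fin.pos (a 0))
  by_cases hab : a = b
  · subst hab
    simp
    positivity
  have hex : ∃ k, a k ≠ b k := by
    by_contra! h
    exact hab (funext h)
  classical
  set k := Nat.find hex with hk
  have h1 : a k ≠ b k := Nat.find_spec hex
  have h2 : ∀ i < k, a i = b i := fun i hi => not_not.1 (Nat.find_min hex hi)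
  have g := Y_gap a b k h2 h1
  have g2 := X_gap a b
  have g3 := Real.abs_ofDigits_sub_ofDigits_le h2
  refine g3.trans ?_
  push_cast
  rw [← Real.mul_rpow (by positivity) (abs_nonneg _)]
  have : ((A : ℝ) ^ k)⁻¹ = (((4 * (A : ℝ)) ^ k)⁻¹) ^ (r : ℝ) := by
    rw [Real.inv_rpow (by positivity), ← Real.rpow_natCast (4 * (A : ℝ)) k,
      ← Real.rpow_mul (by positivity), mul_comm (k : ℝ), Real.rpow_mul (by positivity), ← hAr,
      Real.rpow_natCast]
  rw [this]
  apply Real.rpow_le_rpow (by positivity) _ r.2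
  calc ((4 * (A : ℝ)) ^ k)⁻¹ = (4 * (A : ℝ)) ^ 2 / 2 * (2 / (4 * (A : ℝ)) *
        (1 / (4 * (A : ℝ)) ^ (k + 1))) := by field_simp; ring
    _ ≤ (4 * (A : ℝ)) ^ 2 / 2 * (2 / (4 * (A : ℝ)) * |Y a - Y b|) := by gcongr
    _ ≤ _ := by gcongr

end ChebAux

open ChebAux in
theorem chebyshev_hyperbolic_dimension_one
    (f₄ : ℝ → ℝ) (hf : ∀ x, f₄ x = 4 * x * (1 - x)) :
    ∀ ε : ℝ, 0 < ε → ∃ δ : ℝ, 0 < δ ∧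
      ENNReal.ofReal (1 - ε) <
        dimH {x ∈ Icc (0 : ℝ) 1 | ∀ n : ℕ, δ ≤ |f₄^[n] x - 1 / 2|} := by
  intro ε hε
  obtain ⟨m, hm⟩ := exists_nat_gt (2 / ε)
  set M := m + 1 with hM
  have hMr : (M : ℝ) = m + 1 := by simp [hM]
  refine ⟨1 / (4 * 2 ^ M : ℝ) ^ 2, by positivity, ?_⟩
  set r : NNReal := (M : NNReal) / (M + 2) with hr
  have hr0 : 0 < r := by rw [hr]; simp only [hM]; positivity
  have hAr : ((2 ^ M : ℕ) : ℝ) = (4 * ((2 ^ M : ℕ) : ℝ)) ^ (r : ℝ) := by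
    push_cast
    rw [show (4 * 2 ^ M : ℝ) = 2 ^ (M + 2) by ring, ← Real.rpow_natCast 2 (M + 2),
      ← Real.rpow_mul (by norm_num), hr]
    push_cast
    rw [mul_div_cancel₀ _ (by positivity : (M : ℝ) + 2 ≠ 0), Real.rpow_natCast]
  have h := dimH_range_le (ι := ℕ → Fin (2 ^ M)) X Real.ofDigits _ r hr0 (holder r hr0 hAr)
  have h1 : (1 : ENNReal) ≤ dimH (range (Real.ofDigits (b := 2 ^ M))) := by
    have hs := Real.ofDigits_SurjOn (b := 2 ^ M) (Nat.one_lt_two_pow (by omega))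
    rw [SurjOn, image_univ] at hs
    refine le_trans ?_ (dimH_mono hs)
    rw [Real.dimH_of_nonempty_interior (by rw [interior_Icc]; exact ⟨1 / 2, by norm_num⟩)]
    simp
  have h2 : (r : ENNReal) ≤ dimH (range (X (A := 2 ^ M))) := by
    have := (ENNReal.le_div_iff_mul_le (Or.inl (by exact_mod_cast hr0.ne'))
      (Or.inl ENNReal.coe_ne_top)).1 (h1.trans h)
    simpa using this
  refine lt_of_lt_of_le ?_ (h2.trans (dimH_mono (range_subset_iff.2 fun a => X_mem f₄ hf a)))
  rw [← ENNReal.ofReal_coe_nnreal, ENNReal.ofReal_lt_ofReal_iff (by exact_mod_cast hr0), hr]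
  push_cast
  rw [lt_div_iff₀ (by positivity), hMr]
  rw [div_lt_iff₀ hε] at hm
  nlinarith
end
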